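/- Lemma: let ψ, θ : L.Formula ℕ, x : ℕ, and zs : List ℕ such that ψ is non-dependent of x in M provided θ and every z appearing in zs satisfies z ≠ x and is semantically non-occurring in θ. Then for every valuation v, (∀ b : M, E zs (fun w => θ.Realize w → ψ.Realize w) (v[x↦b])) ↔ ((∃ b : M, θ.Realize (v[x↦b])) → E zs (fun w => ∀ b : M, θ.Realize (w[x↦b]) → ψ.Realize (w[x↦b])) v). Consequently, if moreover for every valuation v there exists b : M with θ.Realize (v[x↦b]), then for every valuation v, (∀ b : M, E zs (fun w => θ.Realize w → ψ.Realize w) (v[x↦b])) ↔ E zs (fun w => ∀ b : M, θ.Realize (w[x↦b]) → ψ.Realize (w[x↦b])) v. -/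

import Mathlib

/-- `φ` is non-dependent of variable `x` in `M` provided `θ`. -/
def NonDepProvided {L : FirstOrder.Language} (M : Type*) [L.Structure M]
    (φ θ : L.Formula ℕ) (x : ℕ) : Prop :=
  ∀ (v : ℕ → M) (b : M), θ.Realize v → θ.Realize (Function.update v x b) →
    (φ.Realize v ↔ φ.Realize (Function.update v x b))

/-- Variable `z` is semantically non-occurring in formula `χ` (in `M`). -/
def SemNonOcc {L : FirstOrder.Language} (M : Type*) [L.Structure M]
    (χ : L.Formula ℕ) (z : ℕ) : Prop :=
  ∀ (v : ℕ → M) (b : M), χ.Realize v ↔ χ.Realize (Function.update v z b)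

/-- Iterated existential quantification over a list of variables. -/
def E {M : Type*} : List ℕ → ((ℕ → M) → Prop) → (ℕ → M) → Prop
  | [], P => P
  | z :: rest, P => fun v => ∃ b : M, E rest P (Function.update v z b)

theorem E_cons {M : Type*} {z : ℕ} {zs : List ℕ} {P : (ℕ → M) → Prop} {v : ℕ → M} :
    E (z :: zs) P v ↔ ∃ b : M, E zs P (Function.update v z b) :=
  Iff.rfl

/-- Iterated existentials over variables other than `x` commute with fixing the value of `x`. -/
theorem E_update_iff {M : Type*} {P : (ℕ → M) → Prop} {x : ℕ} {zs : List ℕ}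
    (hzs : ∀ z ∈ zs, z ≠ x) (v : ℕ → M) (b : M) :
    E zs P (Function.update v x b) ↔ E zs (fun w => P (Function.update w x b)) v := by
  induction zs generalizing v with
  | nil => exact Iff.rfl
  | cons z zs ih =>
    rw [List.forall_mem_cons] at hzs
    simp only [E_cons, Function.update_comm hzs.1.symm, ih hzs.2]

/-- Monotonicity of the iterated existential, relative to a property `I` of valuations that is
preserved by updating the quantified variables. -/
theorem E_mono_of_invariant {M : Type*} {I P Q : (ℕ → M) → Prop} {zs : List ℕ}
    (hI : ∀ z ∈ zs, ∀ v b, I v → I (Function.update v z b))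
    (hPQ : ∀ v, I v → P v → Q v) {v : ℕ → M} (hv : I v) (h : E zs P v) : E zs Q v := by
  induction zs generalizing v with
  | nil => exact hPQ v hv h
  | cons z zs ih =>
    rw [List.forall_mem_cons] at hI
    obtain ⟨b, hb⟩ := h
    exact ⟨b, ih hI.2 (hI.1 v b hv) hb⟩

theorem E_true {M : Type*} [Nonempty M] (zs : List ℕ) (v : ℕ → M) :
    E zs (fun _ => True) v := by
  induction zs generalizing v with
  | nil => trivial
  | cons z zs ih => exact ⟨Classical.arbitrary M, ih _⟩

theorem SemNonOcc.realize_update_update_iff {L : FirstOrder.Language} {M : Type*} [L.Structure M]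
    {χ : L.Formula ℕ} {x z : ℕ} (h : SemNonOcc M χ z) (hzx : z ≠ x) (v : ℕ → M) (b c : M) :
    χ.Realize (Function.update (Function.update v z c) x b) ↔
      χ.Realize (Function.update v x b) := by
  rw [Function.update_comm hzx]
  exact (h _ c).symm

theorem stmt11 {L : FirstOrder.Language} {M : Type*} [L.Structure M] [Nonempty M]
    (ψ θ : L.Formula ℕ) (x : ℕ) (zs : List ℕ)
    (hψ : NonDepProvided M ψ θ x)
    (hzs : ∀ z ∈ zs, z ≠ x ∧ SemNonOcc M θ z) :
    (∀ v : ℕ → M,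
      (∀ b : M, E zs (fun w => θ.Realize w → ψ.Realize w) (Function.update v x b)) ↔
        ((∃ b : M, θ.Realize (Function.update v x b)) →
          E zs (fun w => ∀ b : M, θ.Realize (Function.update w x b) →
            ψ.Realize (Function.update w x b)) v)) ∧
    ((∀ v : ℕ → M, ∃ b : M, θ.Realize (Function.update v x b)) →
      ∀ v : ℕ → M,
        (∀ b : M, E zs (fun w => θ.Realize w → ψ.Realize w) (Function.update v x b)) ↔
          E zs (fun w => ∀ b : M, θ.Realize (Function.update w x b) →
            ψ.Realize (Function.update w x b)) v) := by
  have main : ∀ v : ℕ → M,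
      (∀ b : M, E zs (fun w => θ.Realize w → ψ.Realize w) (Function.update v x b)) ↔
        ((∃ b : M, θ.Realize (Function.update v x b)) →
          E zs (fun w => ∀ b : M, θ.Realize (Function.update w x b) →
            ψ.Realize (Function.update w x b)) v) := by
    intro v
    simp only [E_update_iff fun z hz => (hzs z hz).1]
    constructor
    · rintro h ⟨b, hb⟩
      refine E_mono_of_invariant (I := fun w => θ.Realize (Function.update w x b))
        (fun z hz w c => ((hzs z hz).2.realize_update_update_iff (hzs z hz).1 w b c).2)
        (fun w hw hP c hc => ?_) hb (h b)
      have hψw := hψ (Function.update w x b) c hw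
      rw [Function.update_idem] at hψw
      exact (hψw hc).1 (hP hw)
    · intro h b
      by_cases hb : θ.Realize (Function.update v x b)
      · exact E_mono_of_invariant (I := fun _ => True) (fun _ _ _ _ => id)
          (fun w _ hw => hw b) trivial (h ⟨b, hb⟩)
      · exact E_mono_of_invariant (I := fun w => ¬ θ.Realize (Function.update w x b))
          (fun z hz w c =>
            mt ((hzs z hz).2.realize_update_update_iff (hzs z hz).1 w b c).1)
          (fun w hw _ hw' => absurd hw' hw) hb (E_true zs v)
  exact ⟨main, fun hθ v => (main v).trans (forall_prop_of_true (hθ v))⟩
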